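/- arXiv:2208.06270 — 2 statements merged into one kernel-verified Lean document; each statement's English description precedes it below -/
import Mathlib

section
/- Let P and Q be probability measures on a standard Borel space with P ≪ Q. Then ∫ (dP/dQ)² dQ ≥ exp( D_KL(P‖Q) ); in particular, the χ²-divergence satisfies χ²(P‖Q) := ∫ (dP/dQ)² dQ − 1 ≥ exp( D_KL(P‖Q) ) − 1. -/
open MeasureTheory Real ENNReal Classical

/-- The Kullback–Leibler divergence `D_KL(P‖Q) = ∫ log (dP/dQ) dP`, valued in
`[0,∞]`: it is `∞` when `log (dP/dQ)` is not `P`-integrable. -/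

noncomputable def klDiv {Ω : Type*} [MeasurableSpace Ω] (P Q : Measure Ω) : ℝ≥0∞ :=
  if Integrable (fun x => Real.log ((P.rnDeriv Q x).toReal)) P then
    ENNReal.ofReal (∫ x, Real.log ((P.rnDeriv Q x).toReal) ∂P)
  else ⊤

/-- The exponential function extended to `[0,∞]`, with `exp ∞ = ∞`. -/
noncomputable def eexp (x : ℝ≥0∞) : ℝ≥0∞ :=
  if x = ⊤ then ⊤ else ENNReal.ofReal (Real.exp x.toReal)

/-- **Second moment of the likelihood ratio dominates `exp(D_KL)`:**
for probability measures `P ≪ Q` on a standard Borel space,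
`∫ (dP/dQ)² dQ ≥ exp (D_KL(P‖Q))`; in particular the χ²-divergence satisfies
`χ²(P‖Q) = ∫ (dP/dQ)² dQ − 1 ≥ exp (D_KL(P‖Q)) − 1` (all in `[0,∞]`). -/
theorem chisq_ge_exp_kl
    {Ω : Type*} [MeasurableSpace Ω] [StandardBorelSpace Ω]
    (P Q : Measure Ω) [IsProbabilityMeasure P] [IsProbabilityMeasure Q]
    (hPQ : P ≪ Q) :
    eexp (klDiv P Q) ≤ ∫⁻ x, (P.rnDeriv Q x) ^ 2 ∂Q ∧
    eexp (klDiv P Q) - 1 ≤ (∫⁻ x, (P.rnDeriv Q x) ^ 2 ∂Q) - 1 := by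
  have key : eexp (klDiv P Q) ≤ ∫⁻ x, (P.rnDeriv Q x) ^ 2 ∂Q := by
    by_cases htop : ∫⁻ x, (P.rnDeriv Q x) ^ 2 ∂Q = ⊤
    · rw [htop]; exact le_top
    have hm : Measurable (P.rnDeriv Q) := Measure.measurable_rnDeriv P Q
    have hPeq : ∫⁻ x, (P.rnDeriv Q x) ^ 2 ∂Q = ∫⁻ x, P.rnDeriv Q x ∂P := by
      rw [← lintegral_rnDeriv_mul hPQ hm.aemeasurable]
      simp only [sq]
    have hPtop : ∫⁻ x, P.rnDeriv Q x ∂P ≠ ⊤ := hPeq ▸ htop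
    have hXP : Integrable (fun x => (P.rnDeriv Q x).toReal) P :=
      integrable_toReal_of_lintegral_ne_top hm.aemeasurable hPtop
    have hXQ : Integrable (fun x => (P.rnDeriv Q x).toReal) Q :=
      Measure.integrable_toReal_rnDeriv
    have hX2 : Integrable (fun x => (P.rnDeriv Q x).toReal ^ 2) Q := by
      have := integrable_toReal_of_lintegral_ne_top (hm.pow_const 2).aemeasurable htop
      simpa [ENNReal.toReal_pow] using this
    have hkl : Integrable (fun x => InformationTheory.klFun (P.rnDeriv Q x).toReal) Q := by
      refine Integrable.mono' ((hX2.sub (hXQ.const_mul 2)).add (integrable_const (1 : ℝ)))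
        (Measurable.aestronglyMeasurable (by fun_prop)) (ae_of_all _ fun x => ?_)
      have h0 : 0 ≤ (P.rnDeriv Q x).toReal := ENNReal.toReal_nonneg
      rw [Real.norm_of_nonneg (InformationTheory.klFun_nonneg h0)]
      simp only [Pi.add_apply, Pi.sub_apply, InformationTheory.klFun]
      generalize (P.rnDeriv Q x).toReal = t at h0
      rcases h0.eq_or_lt with h | h
      · simp [← h]
      · nlinarith [Real.log_le_sub_one_of_pos h]
    have hlog : Integrable (llr P Q) P :=
      (InformationTheory.integrable_klFun_rnDeriv_iff hPQ).1 hkl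
    have hnn : 0 ≤ ∫ x, llr P Q x ∂P := by
      simpa using InformationTheory.integral_llr_add_sub_measure_univ_nonneg hPQ hlog
    have hexp : (fun x => Real.exp (llr P Q x)) =ᵐ[P] fun x => (P.rnDeriv Q x).toReal := by
      exact exp_llr_of_ac P Q hPQ
    have hJ : Real.exp (∫ x, llr P Q x ∂P) ≤ ∫ x, Real.exp (llr P Q x) ∂P :=
      convexOn_exp.map_integral_le Real.continuous_exp.continuousOn isClosed_univ
        (ae_of_all _ fun _ => Set.mem_univ _) hlog (hXP.congr hexp.symm)
    have hk : klDiv P Q = ENNReal.ofReal (∫ x, llr P Q x ∂P) := if_pos hlog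
    rw [hk, eexp, if_neg ENNReal.ofReal_ne_top, ENNReal.toReal_ofReal hnn, hPeq]
    refine ENNReal.ofReal_le_of_le_toReal (hJ.trans ?_)
    rw [integral_congr_ae hexp, integral_toReal hm.aemeasurable
      (ae_lt_top hm hPtop)]
  exact ⟨key, tsub_le_tsub_right key 1⟩
end

section
/- Let α ∈ (0, min{ 2/(3√3) , 1 − 2/(3√3) }). There exist constants c₁, c₂, c₃, c₄ > 0, not depending on P, Q, m, n, or ε, such that for all probability measures P and Q on a standard Borel space, all integers m, n ≥ 1, and all ε > 0, Prob[ |R₂^(α)(P_m‖Q_n) − E[R₂^(α)(P_m‖Q_n)]| > ε ] ≤ 2 exp( − ε² / ( (c₁/n) log²(c₂ n) + (c₃/(α² m)) log²(c₄ m) ) ), where R₂^(α)(P'‖Q') := (1/2) log ∫ (dP'/d(αP' + (1−α)Q')) dP' for any probability measures P', Q', P_m and Q_n are the empirical measures of m i.i.d. samples from P and, independently, n i.i.d. samples from Q, and probability and expectation are with respect to the joint law of all samples. -/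
open MeasureTheory Real ENNReal

/-- The `α`-skew mixture `αP + (1-α)Q` of two measures. -/
noncomputable def mixture {Ω : Type*} [MeasurableSpace Ω] (α : ℝ) (P Q : Measure Ω) :
    Measure Ω :=
  ENNReal.ofReal α • P + ENNReal.ofReal (1 - α) • Q

/-- The empirical measure `(1/k) Σ_i δ_{x_i}` of a `k`-tuple of points. -/
noncomputable def empMeas {Ω : Type*} [MeasurableSpace Ω] {k : ℕ} (xs : Fin k → Ω) :
    Measure Ω :=
  (k : ℝ≥0∞)⁻¹ • ∑ i : Fin k, Measure.dirac (xs i)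

/-- The `α`-skew Rényi divergence of order 2:
`R₂^(α)(P‖Q) = (1/2) log ∫ (dP/d(αP + (1−α)Q)) dP`. -/
noncomputable def renyi2Skew {Ω : Type*} [MeasurableSpace Ω] (α : ℝ)
    (P Q : Measure Ω) : ℝ :=
  (1 / 2) * Real.log (∫ x, (P.rnDeriv (mixture α P Q) x).toReal ∂P)

open ProbabilityTheory

namespace SkewRenyi

lemma bdd_integrable {X : Type*} [MeasurableSpace X] (μ : Measure X) [IsProbabilityMeasure μ]
    {f : X → ℝ} (hf : Measurable f) {B : ℝ} (hB : ∀ x, |f x| ≤ B) : Integrable f μ :=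
  Integrable.of_bound hf.aestronglyMeasurable B (Filter.Eventually.of_forall hB)

lemma exp_integrable {X : Type*} [MeasurableSpace X] (μ : Measure X) [IsProbabilityMeasure μ]
    {f : X → ℝ} (hf : Measurable f) {B : ℝ} (hB : ∀ x, |f x| ≤ B) (t a : ℝ) :
    Integrable (fun x => Real.exp (t * (f x - a))) μ := by
  refine bdd_integrable μ (by fun_prop) (B := Real.exp (|t| * (B + |a|))) fun x => ?_
  rw [abs_of_pos (Real.exp_pos _)]
  apply Real.exp_le_exp.2
  calc t * (f x - a) ≤ |t * (f x - a)| := le_abs_self _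
    _ = |t| * |f x - a| := abs_mul _ _
    _ ≤ |t| * (B + |a|) := by
      gcongr
      exact (abs_sub _ _).trans (by linarith [hB x])

lemma abs_integral_le {X : Type*} [MeasurableSpace X] (μ : Measure X) [IsProbabilityMeasure μ]
    {f : X → ℝ} {B : ℝ} (hB : ∀ x, |f x| ≤ B) : |∫ x, f x ∂μ| ≤ B := by
  have := norm_integral_le_of_norm_le_const (μ := μ) (f := f) (C := B)
    (Filter.Eventually.of_forall hB)
  simpa using this

/-- Sub-Gaussian bound on the centred moment generating function. -/
def SubG {X : Type*} [MeasurableSpace X] (μ : Measure X) (f : X → ℝ) (K : ℝ) : Prop :=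
  ∀ t : ℝ, ∫ x, Real.exp (t * (f x - ∫ y, f y ∂μ)) ∂μ ≤ Real.exp (K * t ^ 2 / 2)

lemma SubG.prod {X Y : Type*} [MeasurableSpace X] [MeasurableSpace Y] (μ : Measure X)
    (ν : Measure Y) [IsProbabilityMeasure μ] [IsProbabilityMeasure ν] {f : X × Y → ℝ}
    (hf : Measurable f) {B : ℝ} (hB : ∀ x, |f x| ≤ B) {K L : ℝ}
    (h1 : ∀ x, SubG ν (fun y => f (x, y)) K)
    (h2 : SubG μ (fun x => ∫ y, f (x, y) ∂ν) L) :
    SubG (μ.prod ν) f (L + K) := by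
  intro t
  have hg : Measurable (fun x => ∫ y, f (x, y) ∂ν) :=
    (hf.stronglyMeasurable.integral_prod_right').measurable
  have hgB : ∀ x, |∫ y, f (x, y) ∂ν| ≤ B := fun x => abs_integral_le ν fun y => hB _
  have hE : ∫ z, f z ∂(μ.prod ν) = ∫ x, ∫ y, f (x, y) ∂ν ∂μ :=
    integral_prod _ (bdd_integrable _ hf hB)
  rw [hE]
  set e := ∫ x, ∫ y, f (x, y) ∂ν ∂μ with he
  have hI := exp_integrable (μ.prod ν) hf hB t e
  rw [integral_prod _ hI]
  calc ∫ x, ∫ y, Real.exp (t * (f (x, y) - e)) ∂ν ∂μ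
      ≤ ∫ x, Real.exp (t * ((∫ y, f (x, y) ∂ν) - e)) * Real.exp (K * t ^ 2 / 2) ∂μ := by
        refine integral_mono hI.integral_prod_left
          ((exp_integrable μ hg hgB t e).mul_const _) fun x => ?_
        have : (fun y => Real.exp (t * (f (x, y) - e))) = fun y =>
            Real.exp (t * ((∫ y, f (x, y) ∂ν) - e)) *
              Real.exp (t * (f (x, y) - ∫ y, f (x, y) ∂ν)) := by
          funext y
          rw [← Real.exp_add]; congr 1; ring
        simp only [this]
        rw [integral_const_mul]
        exact mul_le_mul_of_nonneg_left (h1 x t) (Real.exp_pos _).le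
    _ = (∫ x, Real.exp (t * ((∫ y, f (x, y) ∂ν) - e)) ∂μ) * Real.exp (K * t ^ 2 / 2) :=
        integral_mul_const _ _
    _ ≤ Real.exp (L * t ^ 2 / 2) * Real.exp (K * t ^ 2 / 2) :=
        mul_le_mul_of_nonneg_right (h2 t) (Real.exp_pos _).le
    _ = Real.exp ((L + K) * t ^ 2 / 2) := by rw [← Real.exp_add]; congr 1; ring

lemma SubG.of_osc {X : Type*} [MeasurableSpace X] (μ : Measure X) [IsProbabilityMeasure μ]
    {f : X → ℝ} (hf : Measurable f) {B : ℝ} (hB : ∀ x, |f x| ≤ B) {c : ℝ}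
    (hc : ∀ x y, |f x - f y| ≤ c) : SubG μ f (c ^ 2) := by
  have hint := bdd_integrable μ hf hB
  have h0 : ∫ x, (f x - ∫ y, f y ∂μ) ∂μ = 0 := by
    rw [integral_sub hint (integrable_const _)]; simp
  have hb : ∀ x, |f x - ∫ y, f y ∂μ| ≤ c := fun x => by
    have : f x - ∫ y, f y ∂μ = ∫ y, (f x - f y) ∂μ := by
      rw [integral_sub (integrable_const _) hint]; simp
    rw [this]
    exact abs_integral_le μ (hc x)
  have h := hasSubgaussianMGF_of_mem_Icc_of_integral_eq_zero (μ := μ)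
    (X := fun x => f x - ∫ y, f y ∂μ) (a := -c) (b := c) (by fun_prop)
    (Filter.Eventually.of_forall fun x => abs_le.1 (hb x)) h0
  intro t
  have := h.mgf_le t
  simp only [mgf] at this
  refine this.trans (le_of_eq ?_)
  congr 3
  simp only [NNReal.coe_pow, NNReal.coe_div, coe_nnnorm, Real.norm_eq_abs, NNReal.coe_ofNat]
  rw [div_pow, sq_abs]; ring

lemma SubG.pi {X : Type*} [MeasurableSpace X] (μ : Measure X) [IsProbabilityMeasure μ]
    {c B : ℝ} : ∀ (k : ℕ) {f : (Fin k → X) → ℝ}, Measurable f → (∀ x, |f x| ≤ B) →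
    (∀ x i a, |f x - f (Function.update x i a)| ≤ c) →
    SubG (Measure.pi fun _ : Fin k => μ) f (k * c ^ 2) := by
  intro k
  induction k with
  | zero =>
    intro f hf hB hc t
    have h : ∀ x, f x = f (fun i => i.elim0) := fun x => congrArg f (Subsingleton.elim _ _)
    simp [h]
  | succ k ih =>
    intro f hf hB hc
    let e := MeasurableEquiv.piFinSuccAbove (fun _ : Fin (k + 1) => X) 0
    have hmp : MeasurePreserving e.symm _ _ :=
      (measurePreserving_piFinSuccAbove (fun _ : Fin (k + 1) => μ) 0).symm
    have hes : ∀ x y, e.symm (x, y) = Fin.cons x y := fun x y => by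
      simp [e, MeasurableEquiv.piFinSuccAbove_symm_apply, Fin.insertNthEquiv]
    have hf' : Measurable (fun z => f (e.symm z)) := hf.comp e.symm.measurable
    have key : SubG (μ.prod (Measure.pi fun _ : Fin k => μ)) (fun z => f (e.symm z))
        (c ^ 2 + k * c ^ 2) := by
      refine SubG.prod _ _ hf' (fun _ => hB _) (fun x => ?_) ?_
      · refine ih (hf'.comp measurable_prodMk_left) (fun _ => hB _) fun y i a => ?_
        simp only [hes]
        have := hc (Fin.cons x y) i.succ a
        rwa [← Fin.cons_update] at this
      · refine SubG.of_osc μ (hf'.stronglyMeasurable.integral_prod_right').measurable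
          (fun x => abs_integral_le _ (fun y => hB _)) (fun x x' => ?_)
        have hi : ∀ x, Integrable (fun y => f (e.symm (x, y))) (Measure.pi fun _ : Fin k => μ) :=
          fun x => bdd_integrable _ (hf'.comp measurable_prodMk_left) (fun _ => hB _)
        rw [← integral_sub (hi x) (hi x')]
        refine abs_integral_le _ fun y => ?_
        simp only [hes]
        have := hc (Fin.cons x y) 0 x'
        rwa [Fin.update_cons_zero] at this
    intro t
    have h := key t
    rw [hmp.integral_comp' f, hmp.integral_comp'
      (fun x => Real.exp (t * (f x - ∫ y, f y ∂(Measure.pi fun _ : Fin (k + 1) => μ))))] at h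
    refine h.trans (le_of_eq ?_)
    congr 1; push_cast; ring

lemma SubG.tail {X : Type*} [MeasurableSpace X] (μ : Measure X) [IsProbabilityMeasure μ]
    {f : X → ℝ} (hf : Measurable f) {B : ℝ} (hB : ∀ x, |f x| ≤ B) {K : ℝ} (hK : 0 ≤ K)
    (h : SubG μ f K) {ε : ℝ} (hε : 0 < ε) :
    (μ {x | ε < |f x - ∫ y, f y ∂μ|}).toReal ≤ 2 * Real.exp (-(ε ^ 2) / (2 * K)) := by
  have hs : HasSubgaussianMGF (fun x => f x - ∫ y, f y ∂μ) ⟨K, hK⟩ μ :=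
    ⟨fun t => exp_integrable μ hf hB t _, fun t => h t⟩
  have h1 := hs.measure_ge_le hε.le
  have h2 := hs.neg.measure_ge_le hε.le
  have hsub : {x | ε < |f x - ∫ y, f y ∂μ|} ⊆ {x | ε ≤ f x - ∫ y, f y ∂μ} ∪
      {x | ε ≤ (-fun x => f x - ∫ y, f y ∂μ) x} := by
    intro x hx
    have hx2 : ε < |f x - ∫ y, f y ∂μ| := hx
    rcases lt_abs.1 hx2 with h | h
    · exact Or.inl h.le
    · exact Or.inr h.le
  have h3 := (measureReal_mono (μ := μ) hsub).trans (measureReal_union_le _ _)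
  change μ.real _ ≤ _
  change _ ≤ Real.exp (-ε ^ 2 / (2 * K)) at h1 h2
  linarith

end SkewRenyi

namespace SkewRenyi

section
variable {Ω : Type*}

open Classical in
/-- Empirical mass of a point. -/
noncomputable def pm {k : ℕ} (xs : Fin k → Ω) (z : Ω) : ℝ :=
  (k : ℝ)⁻¹ * ∑ i, if xs i = z then 1 else 0

lemma pm_nonneg {k : ℕ} (xs : Fin k → Ω) (z : Ω) : 0 ≤ pm xs z := by
  unfold pm
  refine mul_nonneg (by positivity) (Finset.sum_nonneg fun i _ => ?_)
  split_ifs <;> norm_num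

lemma pm_self_pos {k : ℕ} (xs : Fin k → Ω) (i : Fin k) : 0 < pm xs (xs i) := by
  classical
  unfold pm
  have hk : 0 < (k : ℝ) := by exact_mod_cast i.pos
  refine mul_pos (by positivity) (Finset.sum_pos' (fun j _ => ?_) ⟨i, Finset.mem_univ _, by simp⟩)
  split_ifs <;> norm_num

/-- Density of the empirical measure with respect to the mixture. -/
noncomputable def Hd (α : ℝ) {m n : ℕ} (xs : Fin m → Ω) (ys : Fin n → Ω) (z : Ω) : ℝ :=
  pm xs z / (α * pm xs z + (1 - α) * pm ys z)

/-- Explicit form of the integral. -/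
noncomputable def Fd (α : ℝ) {m n : ℕ} (xs : Fin m → Ω) (ys : Fin n → Ω) : ℝ :=
  (m : ℝ)⁻¹ * ∑ i, Hd α xs ys (xs i)

/-- Variational objective. -/
noncomputable def Phi (α : ℝ) {m n : ℕ} (h : Ω → ℝ) (xs : Fin m → Ω) (ys : Fin n → Ω) : ℝ :=
  (m : ℝ)⁻¹ * ∑ i, (2 * h (xs i) - α * h (xs i) ^ 2) - (1 - α) * ((n : ℝ)⁻¹ * ∑ j, h (ys j) ^ 2)

lemma Hd_mem {α : ℝ} (h0 : 0 < α) (h1 : α < 1) {m n : ℕ} (xs : Fin m → Ω) (ys : Fin n → Ω)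
    (z : Ω) : 0 ≤ Hd α xs ys z ∧ Hd α xs ys z ≤ α⁻¹ := by
  have hp := pm_nonneg xs z
  have hq := pm_nonneg ys z
  have hq' : 0 ≤ (1 - α) * pm ys z := mul_nonneg (by linarith) hq
  have hd : 0 ≤ α * pm xs z + (1 - α) * pm ys z := by positivity
  refine ⟨div_nonneg hp hd, ?_⟩
  unfold Hd
  refine div_le_of_le_mul₀ hd (by positivity) ?_
  rw [mul_add, inv_mul_cancel_left₀ h0.ne']
  have : 0 ≤ α⁻¹ * ((1 - α) * pm ys z) := by positivity
  linarith

lemma sum_fiber {k : ℕ} (xs : Fin k → Ω) (S : Finset Ω) (hS : ∀ i, xs i ∈ S) (g : Ω → ℝ) :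
    (k : ℝ)⁻¹ * ∑ i, g (xs i) = ∑ z ∈ S, pm xs z * g z := by
  classical
  simp only [pm, mul_assoc, ← Finset.mul_sum, Finset.sum_mul]
  congr 1
  rw [Finset.sum_comm]
  refine Finset.sum_congr rfl fun i _ => ?_
  simp [hS i]

lemma Phi_le_Fd {α : ℝ} (h0 : 0 < α) (h1 : α < 1) {m n : ℕ} (h : Ω → ℝ) (xs : Fin m → Ω)
    (ys : Fin n → Ω) : Phi α h xs ys ≤ Fd α xs ys ∧ Phi α (Hd α xs ys) xs ys = Fd α xs ys := by
  classical
  set S : Finset Ω := Finset.univ.image xs ∪ Finset.univ.image ys with hS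
  have hx : ∀ i, xs i ∈ S := fun i => by simp [hS]
  have hy : ∀ i, ys i ∈ S := fun i => by simp [hS]
  have hPhi : ∀ h : Ω → ℝ, Phi α h xs ys = ∑ z ∈ S,
      (2 * pm xs z * h z - (α * pm xs z + (1 - α) * pm ys z) * h z ^ 2) := fun h => by
    unfold Phi
    rw [sum_fiber xs S hx (fun z => 2 * h z - α * h z ^ 2), sum_fiber ys S hy (fun z => h z ^ 2),
      Finset.mul_sum, ← Finset.sum_sub_distrib]
    refine Finset.sum_congr rfl fun z _ => by ring
  have hF : Fd α xs ys = ∑ z ∈ S, pm xs z * Hd α xs ys z := sum_fiber xs S hx _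
  have hH : ∀ z, (α * pm xs z + (1 - α) * pm ys z) * Hd α xs ys z = pm xs z := fun z => by
    have hp := pm_nonneg xs z
    have hq := pm_nonneg ys z
    unfold Hd
    rcases hp.eq_or_lt with h | h
    · rw [← h]; simp
    · have : 0 < α * pm xs z + (1 - α) * pm ys z := by
        have : 0 ≤ (1 - α) * pm ys z := mul_nonneg (by linarith) hq
        positivity
      field_simp
  constructor
  · rw [hPhi, hF]
    refine Finset.sum_le_sum fun z _ => ?_
    have hp := pm_nonneg xs z
    have hq := pm_nonneg ys z
    have hd : 0 ≤ α * pm xs z + (1 - α) * pm ys z :=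
      add_nonneg (mul_nonneg h0.le hp) (mul_nonneg (by linarith) hq)
    have := mul_nonneg hd (sq_nonneg (h z - Hd α xs ys z))
    have h3 := hH z
    generalize α * pm xs z + (1 - α) * pm ys z = D at *
    rw [← h3]
    linarith
  · rw [hPhi, hF]
    refine Finset.sum_congr rfl fun z _ => ?_
    have h3 := hH z
    rw [sq, ← mul_assoc, h3]; ring

lemma one_le_Fd {α : ℝ} (h0 : 0 < α) (h1 : α < 1) {m n : ℕ} (hm : 1 ≤ m) (hn : 1 ≤ n)
    (xs : Fin m → Ω) (ys : Fin n → Ω) : 1 ≤ Fd α xs ys := by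
  refine le_trans (le_of_eq ?_) (Phi_le_Fd h0 h1 (fun _ => 1) xs ys).1
  have hm' : (m : ℝ) ≠ 0 := by positivity
  have hn' : (n : ℝ) ≠ 0 := by positivity
  simp [Phi]
  field_simp
  ring

lemma Fd_le {α : ℝ} (h0 : 0 < α) (h1 : α < 1) {m n : ℕ} (hm : 1 ≤ m)
    (xs : Fin m → Ω) (ys : Fin n → Ω) : Fd α xs ys ≤ α⁻¹ := by
  have hm' : (m : ℝ) ≠ 0 := by positivity
  calc Fd α xs ys ≤ (m : ℝ)⁻¹ * ∑ i : Fin m, α⁻¹ := by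
        unfold Fd; gcongr; exact (Hd_mem h0 h1 xs ys _).2
    _ = α⁻¹ := by simp; field_simp

lemma sum_update_sub {k : ℕ} (xs : Fin k → Ω) (i : Fin k) (a : Ω) (g : Ω → ℝ) :
    ∑ j, g (Function.update xs i a j) = ∑ j, g (xs j) - g (xs i) + g a := by
  classical
  rw [← Finset.add_sum_erase _ (fun j => g (Function.update xs i a j)) (Finset.mem_univ i),
    ← Finset.add_sum_erase _ (fun j => g (xs j)) (Finset.mem_univ i)]
  have : ∀ j ∈ Finset.univ.erase i, g (Function.update xs i a j) = g (xs j) := fun j hj => by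
    rw [Function.update_of_ne (Finset.ne_of_mem_erase hj)]
  rw [Finset.sum_congr rfl this]
  simp
  ring

lemma Fd_update_x {α : ℝ} (h0 : 0 < α) (h1 : α < 1) {m n : ℕ}
    (xs : Fin m → Ω) (ys : Fin n → Ω) (i : Fin m) (a : Ω) :
    Fd α xs ys ≤ Fd α (Function.update xs i a) ys + α⁻¹ / m := by
  have hm' : (0 : ℝ) < m := by exact_mod_cast i.pos
  rw [← (Phi_le_Fd h0 h1 (fun _ => 0) xs ys).2]
  refine le_trans ?_ (add_le_add_left
    (Phi_le_Fd h0 h1 (Hd α xs ys) (Function.update xs i a) ys).1 _)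
  unfold Phi
  rw [sum_update_sub xs i a (fun z => 2 * Hd α xs ys z - α * Hd α xs ys z ^ 2)]
  have hr : ∀ z, 0 ≤ 2 * Hd α xs ys z - α * Hd α xs ys z ^ 2 ∧
      2 * Hd α xs ys z - α * Hd α xs ys z ^ 2 ≤ α⁻¹ := fun z => by
    obtain ⟨ha, hb⟩ := Hd_mem h0 h1 xs ys z
    generalize Hd α xs ys z = H at *
    have hb' : α * H ≤ 1 := by
      calc α * H ≤ α * α⁻¹ := by gcongr
        _ = 1 := mul_inv_cancel₀ h0.ne'
    constructor
    · nlinarith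
    · rw [← one_div, le_div_iff₀ h0]; nlinarith [sq_nonneg (α * H - 1)]
  have hA := (hr (xs i)).2
  have hB := (hr a).1
  have : (m : ℝ)⁻¹ * ((2 * Hd α xs ys (xs i) - α * Hd α xs ys (xs i) ^ 2) -
      (2 * Hd α xs ys a - α * Hd α xs ys a ^ 2)) ≤ α⁻¹ / m := by
    rw [div_eq_inv_mul]; gcongr; linarith
  linarith

lemma Fd_update_y {α : ℝ} (h0 : 0 < α) (h1 : α < 1) {m n : ℕ}
    (xs : Fin m → Ω) (ys : Fin n → Ω) (i : Fin n) (a : Ω) :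
    Fd α xs ys ≤ Fd α xs (Function.update ys i a) + (α⁻¹) ^ 2 / n := by
  have hm' : (0 : ℝ) < n := by exact_mod_cast i.pos
  rw [← (Phi_le_Fd h0 h1 (fun _ => 0) xs ys).2]
  refine le_trans ?_ (add_le_add_left
    (Phi_le_Fd h0 h1 (Hd α xs ys) xs (Function.update ys i a)).1 _)
  unfold Phi
  rw [sum_update_sub ys i a (fun z => Hd α xs ys z ^ 2)]
  have ha := pow_le_pow_left₀ (Hd_mem h0 h1 xs ys a).1 (Hd_mem h0 h1 xs ys a).2 2
  have hb := sq_nonneg (Hd α xs ys (ys i))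
  have h3 : (1 - α) * ((n : ℝ)⁻¹ * (Hd α xs ys a ^ 2 - Hd α xs ys (ys i) ^ 2)) ≤ α⁻¹ ^ 2 / n := by
    rw [div_eq_inv_mul]
    have h4 : (n : ℝ)⁻¹ * (Hd α xs ys a ^ 2 - Hd α xs ys (ys i) ^ 2) ≤ (n : ℝ)⁻¹ * α⁻¹ ^ 2 := by
      gcongr; linarith
    have h5 : 0 ≤ (n : ℝ)⁻¹ * α⁻¹ ^ 2 := by positivity
    nlinarith
  linarith

lemma log_sub_le {a b c : ℝ} (ha : 1 ≤ a) (hb : 1 ≤ b) (h1 : a ≤ b + c) (h2 : b ≤ a + c) :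
    |1 / 2 * Real.log a - 1 / 2 * Real.log b| ≤ c := by
  have key : ∀ {a b : ℝ}, 1 ≤ a → 1 ≤ b → a ≤ b + c → 0 ≤ c →
      Real.log a - Real.log b ≤ c := by
    intro a b ha hb h hc
    rw [← Real.log_div (by positivity) (by positivity)]
    refine (Real.log_le_sub_one_of_pos (by positivity)).trans ?_
    rw [sub_le_iff_le_add, div_le_iff₀ (by positivity)]
    nlinarith
  have hc : 0 ≤ c := by linarith
  have := key ha hb h1 hc
  have := key hb ha h2 hc
  rw [abs_le]; constructor <;> linarith

variable [MeasurableSpace Ω]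

lemma measurable_Fd [MeasurableEq Ω] (α : ℝ) {m n : ℕ} :
    Measurable (fun s : (Fin m → Ω) × (Fin n → Ω) => Fd α s.1 s.2) := by
  unfold Fd Hd pm
  have h1 : ∀ (i j : Fin m), Measurable (fun s : (Fin m → Ω) × (Fin n → Ω) =>
      (open Classical in if s.1 j = s.1 i then (1 : ℝ) else 0)) := fun i j =>
    Measurable.ite (measurableSet_eq_fun (by fun_prop) (by fun_prop)) measurable_const
      measurable_const
  have h2 : ∀ (i : Fin m) (j : Fin n), Measurable (fun s : (Fin m → Ω) × (Fin n → Ω) =>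
      (open Classical in if s.2 j = s.1 i then (1 : ℝ) else 0)) := fun i j =>
    Measurable.ite (measurableSet_eq_fun (by fun_prop) (by fun_prop)) measurable_const
      measurable_const
  fun_prop

lemma empMeas_singleton [MeasurableSingletonClass Ω] {k : ℕ} (xs : Fin k → Ω) (z : Ω) :
    empMeas xs {z} = ENNReal.ofReal (pm xs z) := by
  classical
  rcases Nat.eq_zero_or_pos k with rfl | hk
  · simp [empMeas, pm]
  have hk' : (0 : ℝ) < k := by exact_mod_cast hk
  unfold empMeas pm
  rw [ENNReal.ofReal_mul (by positivity), ENNReal.ofReal_inv_of_pos hk', ENNReal.ofReal_natCast,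
    ENNReal.ofReal_sum_of_nonneg (fun i _ => by split_ifs <;> norm_num)]
  simp only [Measure.smul_apply, Measure.finsetSum_apply, smul_eq_mul]
  congr 1
  refine Finset.sum_congr rfl fun i _ => ?_
  by_cases h : xs i = z <;> simp [h]

lemma integral_empMeas [MeasurableSingletonClass Ω] {k : ℕ} (xs : Fin k → Ω) (g : Ω → ℝ) :
    ∫ x, g x ∂(empMeas xs) = (k : ℝ)⁻¹ * ∑ i, g (xs i) := by
  unfold empMeas
  rw [integral_smul_measure, integral_finsetSum_measure (fun i _ => integrable_dirac (by simp))]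
  simp

instance {k : ℕ} (xs : Fin k → Ω) : IsFiniteMeasure (empMeas xs) := by
  rcases Nat.eq_zero_or_pos k with rfl | hk
  · unfold empMeas; simp; infer_instance
  · unfold empMeas
    refine Measure.smul_finite _ ?_
    simp [hk.ne']

lemma renyi_eq [MeasurableSingletonClass Ω] {α : ℝ} (h0 : 0 < α) (h1 : α < 1) {m n : ℕ}
    (xs : Fin m → Ω) (ys : Fin n → Ω) :
    renyi2Skew α (empMeas xs) (empMeas ys) = 1 / 2 * Real.log (Fd α xs ys) := by
  unfold renyi2Skew
  rw [integral_empMeas]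
  unfold Fd
  congr 3
  refine Finset.sum_congr rfl fun i _ => ?_
  set M := mixture α (empMeas xs) (empMeas ys) with hM
  have : IsFiniteMeasure M := by
    have a1 : IsFiniteMeasure (ENNReal.ofReal α • empMeas xs) :=
      Measure.smul_finite _ ENNReal.ofReal_ne_top
    have a2 : IsFiniteMeasure (ENNReal.ofReal (1 - α) • empMeas ys) :=
      Measure.smul_finite _ ENNReal.ofReal_ne_top
    rw [hM]; unfold mixture; infer_instance
  have hac : empMeas xs ≪ M := by
    intro s hs
    rw [hM] at hs
    simp only [mixture, Measure.add_apply, Measure.smul_apply, smul_eq_mul, add_eq_zero,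
      mul_eq_zero, ENNReal.ofReal_eq_zero, not_le.2 h0, false_or] at hs
    exact hs.1
  have h := Measure.setLIntegral_rnDeriv hac {xs i}
  rw [lintegral_singleton, empMeas_singleton] at h
  have hMs : M {xs i} = ENNReal.ofReal (α * pm xs (xs i) + (1 - α) * pm ys (xs i)) := by
    rw [hM, ENNReal.ofReal_add (mul_nonneg h0.le (pm_nonneg _ _))
      (mul_nonneg (by linarith) (pm_nonneg _ _)), ENNReal.ofReal_mul h0.le,
      ENNReal.ofReal_mul (by linarith)]
    simp [mixture, empMeas_singleton]
  have hp := pm_self_pos xs i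
  have hq := mul_nonneg (by linarith : 0 ≤ 1 - α) (pm_nonneg ys (xs i))
  have hD : 0 < α * pm xs (xs i) + (1 - α) * pm ys (xs i) := by positivity
  have h' := congrArg ENNReal.toReal h
  rw [hMs, ENNReal.toReal_mul, ENNReal.toReal_ofReal hD.le, ENNReal.toReal_ofReal hp.le] at h'
  unfold Hd
  rw [eq_div_iff hD.ne', h']

end

end SkewRenyi

/-- **Concentration of the empirical α-skew Rényi divergence of order 2:**
for every `α ∈ (0, min (2/(3√3)) (1 − 2/(3√3)))` there are constants
`c₁, c₂, c₃, c₄ > 0`, independent of `P`, `Q`, `m`, `n`, `ε`, such that for all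
probability measures `P, Q` on a standard Borel space, all `m, n ≥ 1` and `ε > 0`,
`Prob[|R₂^(α)(P_m‖Q_n) − E[R₂^(α)(P_m‖Q_n)]| > ε]
  ≤ 2 exp(−ε² / ((c₁/n) log²(c₂ n) + (c₃/(α² m)) log²(c₄ m)))`. -/
theorem skew_renyi2_empirical_concentration
    (α : ℝ)
    (hα : α ∈ Set.Ioo (0 : ℝ)
      (min (2 / (3 * Real.sqrt 3)) (1 - 2 / (3 * Real.sqrt 3)))) :
    ∃ c₁ c₂ c₃ c₄ : ℝ, 0 < c₁ ∧ 0 < c₂ ∧ 0 < c₃ ∧ 0 < c₄ ∧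
      ∀ (Ω : Type) [MeasurableSpace Ω] [StandardBorelSpace Ω]
        (P Q : Measure Ω) [IsProbabilityMeasure P] [IsProbabilityMeasure Q],
        ∀ m n : ℕ, 1 ≤ m → 1 ≤ n → ∀ ε : ℝ, 0 < ε →
          (((Measure.pi fun _ : Fin m => P).prod (Measure.pi fun _ : Fin n => Q))
              {s : (Fin m → Ω) × (Fin n → Ω) |
                ε < |renyi2Skew α (empMeas s.1) (empMeas s.2)
                  - ∫ t, renyi2Skew α (empMeas t.1) (empMeas t.2)
                      ∂((Measure.pi fun _ : Fin m => P).prod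
                          (Measure.pi fun _ : Fin n => Q))|}).toReal
            ≤ 2 * Real.exp (-(ε ^ 2) /
                ((c₁ / n) * (Real.log (c₂ * n)) ^ 2
                  + (c₃ / (α ^ 2 * m)) * (Real.log (c₄ * m)) ^ 2)) := by
  have h0 : 0 < α := hα.1
  have h1 : α < 1 := by
    have h := hα.2.trans_le (min_le_right _ _)
    have : 0 < 2 / (3 * Real.sqrt 3) := by positivity
    linarith
  refine ⟨2 * (α⁻¹ ^ 2) ^ 2, Real.exp 1, 2, Real.exp 1, by positivity, by positivity,
    by positivity, by positivity, ?_⟩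
  intro Ω _ _ P Q _ _ m n hm hn ε hε
  have hm' : (0 : ℝ) < m := by exact_mod_cast hm
  have hn' : (0 : ℝ) < n := by exact_mod_cast hn
  set f : (Fin m → Ω) × (Fin n → Ω) → ℝ := fun s => 1 / 2 * Real.log (SkewRenyi.Fd α s.1 s.2)
    with hf
  have heq : ∀ s : (Fin m → Ω) × (Fin n → Ω),
      renyi2Skew α (empMeas s.1) (empMeas s.2) = f s := fun s => SkewRenyi.renyi_eq h0 h1 _ _
  simp only [heq]
  have hfm : Measurable f := by
    have := SkewRenyi.measurable_Fd (Ω := Ω) α (m := m) (n := n)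
    rw [hf]; fun_prop
  have hB : ∀ s, |f s| ≤ 1 / 2 * Real.log α⁻¹ := fun s => by
    have ha := SkewRenyi.one_le_Fd h0 h1 hm hn s.1 s.2
    have hb := SkewRenyi.Fd_le h0 h1 hm s.1 s.2
    have h3 := Real.log_nonneg ha
    have h4 := Real.log_le_log (by linarith) hb
    rw [hf, abs_of_nonneg (by positivity)]
    linarith
  have hx : ∀ xs ys i a, |f (xs, ys) - f (Function.update xs i a, ys)| ≤ α⁻¹ / m :=
    fun xs ys i a => by
      refine SkewRenyi.log_sub_le (SkewRenyi.one_le_Fd h0 h1 hm hn _ _)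
        (SkewRenyi.one_le_Fd h0 h1 hm hn _ _) (SkewRenyi.Fd_update_x h0 h1 xs ys i a) ?_
      have := SkewRenyi.Fd_update_x h0 h1 (Function.update xs i a) ys i (xs i)
      simpa using this
  have hy : ∀ xs ys i a, |f (xs, ys) - f (xs, Function.update ys i a)| ≤ α⁻¹ ^ 2 / n :=
    fun xs ys i a => by
      refine SkewRenyi.log_sub_le (SkewRenyi.one_le_Fd h0 h1 hm hn _ _)
        (SkewRenyi.one_le_Fd h0 h1 hm hn _ _) (SkewRenyi.Fd_update_y h0 h1 xs ys i a) ?_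
      have := SkewRenyi.Fd_update_y h0 h1 xs (Function.update ys i a) i (ys i)
      simpa using this
  have hsub : SkewRenyi.SubG ((Measure.pi fun _ : Fin m => P).prod (Measure.pi fun _ : Fin n => Q))
      f (m * (α⁻¹ / m) ^ 2 + n * (α⁻¹ ^ 2 / n) ^ 2) := by
    refine SkewRenyi.SubG.prod _ _ hfm hB (fun xs => ?_) ?_
    · exact SkewRenyi.SubG.pi Q n (hfm.comp measurable_prodMk_left) (fun _ => hB _)
        (fun ys i a => hy xs ys i a)
    · refine SkewRenyi.SubG.pi P m (hfm.stronglyMeasurable.integral_prod_right').measurable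
        (fun xs => SkewRenyi.abs_integral_le _ (fun _ => hB _)) (fun xs i a => ?_)
      have hi : ∀ xs, Integrable (fun ys => f (xs, ys)) (Measure.pi fun _ : Fin n => Q) :=
        fun xs => SkewRenyi.bdd_integrable _ (hfm.comp measurable_prodMk_left) (fun _ => hB _)
      rw [← integral_sub (hi _) (hi _)]
      exact SkewRenyi.abs_integral_le _ fun ys => hx xs ys i a
  refine (SkewRenyi.SubG.tail _ hfm hB (by positivity) hsub hε).trans ?_
  have hlog : ∀ k : ℕ, 1 ≤ k → 1 ≤ (Real.log (Real.exp 1 * k)) ^ 2 := fun k hk => by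
    have hk' : (1 : ℝ) ≤ k := by exact_mod_cast hk
    rw [Real.log_mul (Real.exp_pos 1).ne' (by positivity), Real.log_exp]
    have := Real.log_nonneg hk'
    nlinarith
  have hL1 := hlog n hn
  have hL2 := hlog m hm
  have hK : 2 * (m * (α⁻¹ / m) ^ 2 + n * (α⁻¹ ^ 2 / n) ^ 2) =
      2 * (α⁻¹ ^ 2) ^ 2 / n * 1 + 2 / (α ^ 2 * m) * 1 := by
    field_simp
    ring
  have hpos : 0 < 2 * (m * (α⁻¹ / m) ^ 2 + n * (α⁻¹ ^ 2 / n) ^ 2) := by positivity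
  have hle : 2 * (m * (α⁻¹ / m) ^ 2 + n * (α⁻¹ ^ 2 / n) ^ 2) ≤
      2 * (α⁻¹ ^ 2) ^ 2 / n * (Real.log (Real.exp 1 * n)) ^ 2
        + 2 / (α ^ 2 * m) * (Real.log (Real.exp 1 * m)) ^ 2 := by
    rw [hK]; gcongr
  rw [neg_div, neg_div]
  gcongr
end
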